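/- arXiv:1907.01524 — 3 statements merged into one kernel-verified Lean document; each statement's English description precedes it below -/
import Mathlib

section
/- Let χ₁, χ₂ be primitive Dirichlet characters of conductors q₁, q₂ respectively, with q₁, q₂ > 1, and let a, c be integers with c ≥ 1, q₁q₂ | c, and gcd(a,c) = 1. Then the series ∑_{l=1}^∞ (χ₁(l)/l) · θ_{χ₂}(a/c + iu, l), where θ_{χ₂}(z,l) = ∑_{k=1}^∞ conj(χ₂)(k)·e(klz), converges uniformly in u on the interval (0, ∞); i.e., the partial sums in l converge uniformly for all u > 0. -/
open Complex

/-- `e(w) = exp(2πiw)`. -/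
noncomputable def eC (w : ℂ) : ℂ := Complex.exp (2 * Real.pi * Complex.I * w)

/-- The holomorphic part `f_{χ₁,χ₂}(z) = ∑_{l≥1} ∑_{k≥1} (χ₁(l) conj(χ₂)(k) / l) e(klz)`. -/
noncomputable def fE {q₁ q₂ : ℕ} (χ₁ : DirichletCharacter ℂ q₁)
    (χ₂ : DirichletCharacter ℂ q₂) (z : ℂ) : ℂ :=
  ∑' l : ℕ+, ∑' k : ℕ+,
    χ₁ ((l : ℕ) : ZMod q₁) * (starRingEnd ℂ) (χ₂ ((k : ℕ) : ZMod q₂)) / (l : ℂ)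
      * eC ((k : ℂ) * (l : ℂ) * z)

/-- The Gauss sum `τ(χ) = ∑_{n mod q} χ(n) e(n/q)`. -/
noncomputable def gaussSum' {q : ℕ} (χ : DirichletCharacter ℂ q) : ℂ :=
  ∑ n ∈ Finset.range q, χ ((n : ℕ) : ZMod q) * eC ((n : ℂ) / (q : ℂ))

/-- The first Bernoulli function, `B₁(x) = x - ⌊x⌋ - 1/2` off ℤ, and `0` on ℤ. -/
noncomputable def B1 (x : ℝ) : ℝ := if Int.fract x = 0 then 0 else Int.fract x - 1 / 2

lemma sbp (A v : ℕ → ℂ) (m n : ℕ) (h : m ≤ n) :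
    ∑ l ∈ Finset.Ico m n, A l * v l =
      (∑ l ∈ Finset.range n, A l) * v n - (∑ l ∈ Finset.range m, A l) * v m
      + ∑ l ∈ Finset.Ico m n, (∑ i ∈ Finset.range (l+1), A i) * (v l - v (l+1)) := by
  induction n, h using Nat.le_induction with
  | base => simp
  | succ n hmn ih =>
    rw [Finset.sum_Ico_succ_top hmn, Finset.sum_Ico_succ_top hmn, ih, Finset.sum_range_succ _ n]
    ring

lemma sum_shift (h : ℕ → ℂ) (c : ℕ) (hp : ∀ n, h (n + c) = h n) (q : ℕ) :
    ∑ b ∈ Finset.range c, h (b + q) = ∑ b ∈ Finset.range c, h b := by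
  induction q with
  | zero => simp
  | succ q ih =>
    rw [← ih]
    have h1 := Finset.sum_range_succ (fun b => h (b + q)) c
    have h2 := Finset.sum_range_succ' (fun b => h (b + q)) c
    have h3 : h (c + q) = h (0 + q) := by rw [add_comm c q, hp, zero_add]
    rw [h1, h3] at h2
    have := add_right_cancel h2
    rw [this]
    refine Finset.sum_congr rfl fun b _ => ?_
    congr 1; ring

lemma char_sum_zero (f : ℕ → ℂ) (q c : ℕ) (hf : ∀ n, f (n + q) = f n) (hfc : ∀ n, f (n + c) = f n)
    (ζ : ℂ) (hζ : IsPrimitiveRoot ζ c) (l : ℕ) (hl : ¬ c ∣ q * l) :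
    ∑ b ∈ Finset.range c, f b * ζ ^ (b * l) = 0 := by
  have h1 := sum_shift (fun b => f b * ζ ^ (b * l)) c (by
    intro n
    simp only [hfc, add_mul, pow_add, pow_mul ζ c, hζ.pow_eq_one, one_pow, mul_one]) q
  have h2 : ∑ b ∈ Finset.range c, f (b+q) * ζ ^ ((b+q) * l)
      = ζ ^ (q * l) * ∑ b ∈ Finset.range c, f b * ζ ^ (b * l) := by
    rw [Finset.mul_sum]
    refine Finset.sum_congr rfl fun b _ => ?_
    rw [hf, add_mul, pow_add]; ring
  beta_reduce at h1
  rw [h2] at h1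
  have h3 : ζ ^ (q * l) ≠ 1 := fun h => hl (hζ.dvd_of_pow_eq_one _ h)
  have h4 : (ζ ^ (q * l) - 1) * ∑ b ∈ Finset.range c, f b * ζ ^ (b * l) = 0 := by
    rw [sub_mul, h1]; ring
  exact (mul_eq_zero.mp h4).resolve_left (sub_ne_zero.mpr h3)

lemma bdd_partial (f : ℕ → ℂ) (c : ℕ) (hc : 1 ≤ c) (hfc : ∀ n, f (n + c) = f n)
    (h0 : ∑ b ∈ Finset.range c, f b = 0) :
    ∃ K : ℝ, 0 ≤ K ∧ ∀ n, ‖∑ b ∈ Finset.range n, f b‖ ≤ K := by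
  have hp : Function.Periodic (fun n => ∑ b ∈ Finset.range n, f b) c := by
    intro n
    induction n with
    | zero => simp [h0]
    | succ n ih =>
      simp only at ih ⊢
      rw [show n + 1 + c = n + c + 1 by ring, Finset.sum_range_succ, Finset.sum_range_succ, ih, hfc]
  refine ⟨∑ n ∈ Finset.range c, ‖∑ b ∈ Finset.range n, f b‖,
    Finset.sum_nonneg fun _ _ => norm_nonneg _, fun n => ?_⟩
  have := hp.map_mod_nat n
  beta_reduce at this
  rw [← this]
  exact Finset.single_le_sum (f := fun n => ‖∑ b ∈ Finset.range n, f b‖)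
    (fun _ _ => norm_nonneg _) (Finset.mem_range.mpr (Nat.mod_lt _ hc))

/-- The kernel `x^b / (1 + x + ... + x^(c-1))`. -/
noncomputable def phi (c b : ℕ) (x : ℝ) : ℝ := x ^ b / ∑ i ∈ Finset.range c, x ^ i

lemma D_ge (c : ℕ) (hc : 1 ≤ c) (x : ℝ) (hx : 0 ≤ x) : 1 ≤ ∑ i ∈ Finset.range c, x ^ i := by
  have := Finset.single_le_sum (f := fun i => x ^ i) (fun i _ => pow_nonneg hx i)
    (Finset.mem_range.mpr hc)
  simpa using this

lemma phi_nonneg (c b : ℕ) (x : ℝ) (hx : 0 ≤ x) : 0 ≤ phi c b x := by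
  unfold phi; positivity

lemma phi_le (c b : ℕ) (hb : b < c) (x : ℝ) (hx : 0 ≤ x) : phi c b x ≤ 1 := by
  have h1 := D_ge c (by omega) x hx
  unfold phi
  rw [div_le_one (by linarith)]
  exact Finset.single_le_sum (f := fun i => x ^ i) (fun i _ => pow_nonneg hx i)
    (Finset.mem_range.mpr hb)

lemma pow_lip (b : ℕ) (x y : ℝ) (hy : 0 ≤ y) (hyx : y ≤ x) (hx : x ≤ 1) :
    x ^ b - y ^ b ≤ b * (x - y) := by
  induction b with
  | zero => simp
  | succ b ih =>
    have h1 : x ^ b ≤ 1 := pow_le_one₀ (hy.trans hyx) hx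
    have h2 : 0 ≤ y ^ b := by positivity
    have h3 : y ^ b ≤ x ^ b := pow_le_pow_left₀ hy hyx b
    push_cast
    rw [pow_succ, pow_succ]
    nlinarith

lemma phi_lip (c b : ℕ) (hb : b < c) : ∃ L : ℝ, 0 ≤ L ∧ ∀ x y : ℝ, 0 ≤ y → y ≤ x → x ≤ 1 →
    |phi c b x - phi c b y| ≤ L * (x - y) := by
  refine ⟨b * c + ∑ i ∈ Finset.range c, (i : ℝ), by positivity, fun x y hy hyx hx => ?_⟩
  have hx0 := hy.trans hyx
  have hDx := D_ge c (by omega) x hx0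
  have hDy := D_ge c (by omega) y hy
  have hD : ∑ i ∈ Finset.range c, x ^ i - ∑ i ∈ Finset.range c, y ^ i
      ≤ (∑ i ∈ Finset.range c, (i : ℝ)) * (x - y) := by
    rw [← Finset.sum_sub_distrib, Finset.sum_mul]
    exact Finset.sum_le_sum fun i _ => pow_lip i x y hy hyx hx
  have hD0 : ∑ i ∈ Finset.range c, y ^ i ≤ ∑ i ∈ Finset.range c, x ^ i :=
    Finset.sum_le_sum fun i _ => pow_le_pow_left₀ hy hyx i
  have hDc : ∑ i ∈ Finset.range c, y ^ i ≤ c := by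
    calc _ ≤ ∑ i ∈ Finset.range c, (1:ℝ) :=
          Finset.sum_le_sum fun i _ => pow_le_one₀ hy (hyx.trans hx)
      _ = c := by simp
  unfold phi
  set P := ∑ i ∈ Finset.range c, x ^ i
  set Q := ∑ i ∈ Finset.range c, y ^ i
  set I := ∑ i ∈ Finset.range c, (i : ℝ)
  have hb1 := pow_lip b x y hy hyx hx
  have hb2 : y ^ b ≤ x ^ b := pow_le_pow_left₀ hy hyx b
  have hb3 : y ^ b ≤ 1 := pow_le_one₀ hy (hyx.trans hx)
  have hb4 : 0 ≤ y ^ b := by positivity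
  have e : x ^ b / P - y ^ b / Q = ((x ^ b - y ^ b) * Q - y ^ b * (P - Q)) / (P * Q) := by
    field_simp; ring
  have hPQ : 1 ≤ P * Q := one_le_mul_of_one_le_of_one_le hDx hDy
  rw [e, abs_div, abs_of_pos (by linarith : 0 < P * Q)]
  refine (div_le_self (abs_nonneg _) hPQ).trans ?_
  have t1 : (x ^ b - y ^ b) * Q ≤ (b * (x - y)) * c :=
    mul_le_mul hb1 hDc (by linarith) (by have := sub_nonneg.mpr hyx; positivity)
  have t1' : 0 ≤ (x ^ b - y ^ b) * Q := mul_nonneg (by linarith) (by linarith)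
  have t2 : y ^ b * (P - Q) ≤ 1 * (I * (x - y)) :=
    mul_le_mul hb3 hD (by linarith) (by norm_num)
  have t2' : 0 ≤ y ^ b * (P - Q) := mul_nonneg hb4 (by linarith)
  rw [abs_le]
  constructor <;> nlinarith

lemma block_bound (A : ℕ → ℂ) (K : ℝ) (hK : 0 ≤ K) (hA : ∀ n, ‖∑ l ∈ Finset.range n, A l‖ ≤ K)
    (φ : ℝ → ℝ) (L : ℝ) (hL : 0 ≤ L) (hφ0 : ∀ x, 0 ≤ x → 0 ≤ φ x) (hφ1 : ∀ x, 0 ≤ x → φ x ≤ 1)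
    (hφ : ∀ x y : ℝ, 0 ≤ y → y ≤ x → x ≤ 1 → |φ x - φ y| ≤ L * (x - y))
    (r : ℝ) (hr0 : 0 ≤ r) (hr1 : r ≤ 1) (m n : ℕ) (hm : 1 ≤ m) (hmn : m ≤ n) :
    ‖∑ l ∈ Finset.Ico m n, A l * ((φ (r ^ l) / l : ℝ) : ℂ)‖ ≤ K * (3 + L) / m := by
  have hm' : (0:ℝ) < m := by exact_mod_cast hm
  have hv : ∀ l : ℕ, m ≤ l → |φ (r ^ l) / l| ≤ 1 / m := by
    intro l hl
    have : (m:ℝ) ≤ l := by exact_mod_cast hl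
    have h0 := hφ0 (r ^ l) (by positivity)
    rw [abs_of_nonneg (by positivity)]
    exact div_le_div₀ (by norm_num) (hφ1 _ (by positivity)) hm' this
  have hd : ∀ l : ℕ, m ≤ l → |φ (r ^ l) / l - φ (r ^ (l+1)) / (l+1 : ℕ)| ≤
      (1 / (l:ℝ) + L / m * r ^ l) - (1 / ((l + 1 : ℕ) : ℝ) + L / m * r ^ (l+1)) := by
    intro l hl
    have hl' : (m:ℝ) ≤ l := by exact_mod_cast hl
    have hl0 : (0:ℝ) < l := by linarith
    have h0 := hφ0 (r ^ l) (by positivity)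
    have h1 := hφ1 (r ^ l) (by positivity)
    have hrr : r ^ (l+1) ≤ r ^ l := pow_le_pow_of_le_one hr0 hr1 (by omega)
    have h2 := hφ (r ^ l) (r ^ (l+1)) (by positivity) hrr (pow_le_one₀ hr0 hr1)
    have e : φ (r ^ l) / l - φ (r ^ (l+1)) / (l+1 : ℕ) = φ (r ^ l) * (1 / l - 1 / (l+1 : ℕ))
        + 1 / (l+1 : ℕ) * (φ (r ^ l) - φ (r ^ (l+1))) := by ring
    have hinv : 1 / ((l+1 : ℕ) : ℝ) ≤ 1 / l :=
      one_div_le_one_div_of_le hl0 (by push_cast; linarith)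
    have hinv2 : 1 / ((l+1 : ℕ) : ℝ) ≤ 1 / m :=
      one_div_le_one_div_of_le hm' (by push_cast; linarith)
    rw [e]
    refine (abs_add_le _ _).trans ?_
    rw [abs_mul, abs_mul, abs_of_nonneg h0, abs_of_nonneg (by linarith : 0 ≤ 1 / (l:ℝ) - 1 / (l+1 : ℕ)),
      abs_of_nonneg (by positivity : (0:ℝ) ≤ 1 / (l+1 : ℕ))]
    have t1 : φ (r ^ l) * (1 / l - 1 / (l+1 : ℕ)) ≤ 1 * (1 / l - 1 / (l+1 : ℕ)) :=
      mul_le_mul_of_nonneg_right h1 (by linarith)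
    have t2 : 1 / ((l+1 : ℕ):ℝ) * |φ (r ^ l) - φ (r ^ (l+1))| ≤ 1 / m * (L * (r ^ l - r ^ (l+1))) :=
      mul_le_mul hinv2 h2 (abs_nonneg _) (by positivity)
    have e2 : 1 / m * (L * (r ^ l - r ^ (l+1))) = L / m * r ^ l - L / m * r ^ (l+1) := by ring
    linarith
  have hsum : ∑ l ∈ Finset.Ico m n, |φ (r ^ l) / l - φ (r ^ (l+1)) / (l+1 : ℕ)| ≤ (1 + L) / m := by
    have h1 : ∑ l ∈ Finset.Ico m n, |φ (r ^ l) / l - φ (r ^ (l+1)) / (l+1 : ℕ)| ≤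
        (1 / (m:ℝ) + L / m * r ^ m) - (1 / (n : ℝ) + L / m * r ^ n) := by
      refine (Finset.sum_le_sum fun l hl => hd l (Finset.mem_Ico.mp hl).1).trans (le_of_eq ?_)
      have e3 := Finset.sum_Ico_sub (fun l : ℕ => -(1 / (l:ℝ) + L / m * r ^ l)) hmn
      beta_reduce at e3
      have e4 : ∑ l ∈ Finset.Ico m n, ((1 / (l:ℝ) + L / m * r ^ l) -
          (1 / ((l + 1 : ℕ) : ℝ) + L / m * r ^ (l+1)))
        = ∑ l ∈ Finset.Ico m n, (-(1 / ((l + 1 : ℕ) : ℝ) + L / m * r ^ (l+1)) -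
          -(1 / (l:ℝ) + L / m * r ^ l)) :=
        Finset.sum_congr rfl fun l _ => by ring
      rw [e4, e3]; ring
    have h2 : L / m * r ^ m ≤ L / m :=
      mul_le_of_le_one_right (by positivity) (pow_le_one₀ hr0 hr1)
    have h3 : 0 ≤ 1 / (n : ℝ) + L / m * r ^ n := by positivity
    rw [add_div]; linarith
  rw [sbp A (fun l => ((φ (r ^ l) / l : ℝ) : ℂ)) m n hmn]
  have b1 : ‖(∑ l ∈ Finset.range n, A l) * ((φ (r ^ n) / n : ℝ) : ℂ)‖ ≤ K * (1 / m) := by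
    rw [norm_mul, Complex.norm_real, Real.norm_eq_abs]
    exact mul_le_mul (hA n) (hv n hmn) (abs_nonneg _) hK
  have b2 : ‖(∑ l ∈ Finset.range m, A l) * ((φ (r ^ m) / m : ℝ) : ℂ)‖ ≤ K * (1 / m) := by
    rw [norm_mul, Complex.norm_real, Real.norm_eq_abs]
    exact mul_le_mul (hA m) (hv m le_rfl) (abs_nonneg _) hK
  have b3 : ‖∑ l ∈ Finset.Ico m n, (∑ i ∈ Finset.range (l+1), A i) *
      (((φ (r ^ l) / l : ℝ) : ℂ) - ((φ (r ^ (l+1)) / (l+1 : ℕ) : ℝ) : ℂ))‖ ≤ K * ((1 + L) / m) := by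
    refine (norm_sum_le _ _).trans ?_
    refine le_trans ?_ (mul_le_mul_of_nonneg_left hsum hK)
    rw [Finset.mul_sum]
    refine Finset.sum_le_sum fun l _ => ?_
    rw [norm_mul, ← Complex.ofReal_sub, Complex.norm_real, Real.norm_eq_abs]
    exact mul_le_mul_of_nonneg_right (hA _) (abs_nonneg _)
  refine (norm_add_le _ _).trans ?_
  have b4 := norm_sub_le ((∑ l ∈ Finset.range n, A l) * ((φ (r ^ n) / n : ℝ) : ℂ))
    ((∑ l ∈ Finset.range m, A l) * ((φ (r ^ m) / m : ℝ) : ℂ))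
  have e5 : K * (3 + L) / m = K * (1 / m) + K * (1 / m) + K * ((1 + L) / m) := by ring
  rw [e5]
  linarith

/-- Evaluation of a power series with `c`-periodic coefficients of mean zero. -/
lemma tsum_periodic (B : ℕ → ℂ) (c : ℕ) (hc : 1 ≤ c) (hB : ∀ n, B (n + c) = B n)
    (hBb : ∀ n, ‖B n‖ ≤ 1)
    (h0 : ∑ b ∈ Finset.range c, B b = 0) (x : ℝ) (hx0 : 0 < x) (hx1 : x < 1) :
    ∑' k, B k * (x:ℂ) ^ k =
      ∑ b ∈ Finset.range c, (∑ i ∈ Finset.range (b+1), B i) * ((phi c b x : ℝ) : ℂ) := by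
  have hs : Summable fun k => B k * (x:ℂ) ^ k := by
    refine Summable.of_norm_bounded (summable_geometric_of_lt_one hx0.le hx1) fun k => ?_
    rw [norm_mul, norm_pow, Complex.norm_real, Real.norm_eq_abs, abs_of_pos hx0]
    exact mul_le_of_le_one_left (by positivity) (hBb k)
  have h1 := hs.sum_add_tsum_nat_add c
  have h2 : ∑' k, B (k + c) * (x:ℂ) ^ (k + c) = (x:ℂ) ^ c * ∑' k, B k * (x:ℂ) ^ k := by
    rw [← tsum_mul_left]
    refine tsum_congr fun k => ?_
    rw [hB, pow_add]; ring
  rw [h2] at h1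
  have h3 := sbp B (fun k => (x:ℂ) ^ k) 0 c (Nat.zero_le _)
  rw [← Finset.range_eq_Ico, h0] at h3
  simp only [Finset.range_zero, Finset.sum_empty, zero_mul, sub_zero, zero_add] at h3
  rw [h3] at h1
  set F := ∑' k, B k * (x:ℂ) ^ k
  have hD := D_ge c hc x hx0.le
  have hgeo : (∑ i ∈ Finset.range c, x ^ i) * (1 - x) = 1 - x ^ c := by
    have := geom_sum_mul x c
    linarith
  have hgeoC : ((∑ i ∈ Finset.range c, x ^ i : ℝ) : ℂ) * (1 - x) = 1 - (x:ℂ) ^ c := by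
    exact_mod_cast congrArg (fun t : ℝ => (t : ℂ)) hgeo
  have hDC : ((∑ i ∈ Finset.range c, x ^ i : ℝ) : ℂ) ≠ 0 := by
    exact_mod_cast (by linarith : (∑ i ∈ Finset.range c, x ^ i) ≠ 0)
  have hx : (1 - (x:ℂ)) ≠ 0 := by
    exact_mod_cast (by linarith : (1 - x) ≠ 0)
  refine mul_left_cancel₀ (mul_ne_zero hDC hx) ?_
  have h4 : (1 - (x:ℂ) ^ c) * F = ∑ b ∈ Finset.range c, (∑ i ∈ Finset.range (b+1), B i) *
      ((x:ℂ) ^ b - (x:ℂ) ^ (b+1)) := by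
    linear_combination -h1
  rw [hgeoC, h4, ← hgeoC, Finset.mul_sum]
  refine Finset.sum_congr rfl fun b _ => ?_
  unfold phi
  push_cast at hDC ⊢
  field_simp
  ring

theorem uniform_convergence_in_u
    {q₁ q₂ : ℕ} (hq₁ : 1 < q₁) (hq₂ : 1 < q₂)
    (χ₁ : DirichletCharacter ℂ q₁) (χ₂ : DirichletCharacter ℂ q₂)
    (hχ₁ : χ₁.IsPrimitive) (hχ₂ : χ₂.IsPrimitive)
    (a : ℤ) (c : ℕ) (hc : 1 ≤ c) (hqc : q₁ * q₂ ∣ c) (hac : Int.gcd a (c : ℤ) = 1) :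
    ∃ g : ℝ → ℂ,
      TendstoUniformlyOn
        (fun (N : ℕ) (u : ℝ) =>
          ∑ l ∈ Finset.Icc 1 N,
            χ₁ ((l : ℕ) : ZMod q₁) / (l : ℂ) *
              ∑' k : ℕ+, (starRingEnd ℂ) (χ₂ ((k : ℕ) : ZMod q₂)) *
                eC ((k : ℂ) * (l : ℂ) * ((a : ℂ) / (c : ℂ) + Complex.I * (u : ℂ))))
        g Filter.atTop (Set.Ioi 0) := by
  have hc0 : c ≠ 0 := by omega
  have hcC : (c : ℂ) ≠ 0 := by exact_mod_cast hc0
  obtain ⟨ζ, hζdef⟩ : ∃ ζ : ℂ, ζ = eC ((a : ℂ) / c) := ⟨_, rfl⟩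
  have hζ : IsPrimitiveRoot ζ c := by
    have h1 := (Complex.isPrimitiveRoot_exp c hc0).zpow_of_gcd_eq_one a hac
    suffices h2 : ζ = Complex.exp (2 * Real.pi * Complex.I / c) ^ a by
      rw [h2]; exact h1
    rw [hζdef, eC, ← Complex.exp_int_mul]
    congr 1
    field_simp
  have hχ₁0 : ∀ l : ℕ, q₁ ∣ l → χ₁ (l : ZMod q₁) = 0 := by
    intro l hl
    rw [(ZMod.natCast_eq_zero_iff l q₁).mpr hl]
    have : Fact (1 < q₁) := ⟨hq₁⟩
    exact χ₁.map_nonunit not_isUnit_zero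
  have hχ₂0 : ∀ l : ℕ, q₂ ∣ l → χ₂ (l : ZMod q₂) = 0 := by
    intro l hl
    rw [(ZMod.natCast_eq_zero_iff l q₂).mpr hl]
    have : Fact (1 < q₂) := ⟨hq₂⟩
    exact χ₂.map_nonunit not_isUnit_zero
  have hp₁ : ∀ n, χ₁ ((n + q₁ : ℕ) : ZMod q₁) = χ₁ (n : ZMod q₁) := by intro n; simp
  have hp₂ : ∀ n, (starRingEnd ℂ) (χ₂ ((n + q₂ : ℕ) : ZMod q₂)) =
    (starRingEnd ℂ) (χ₂ (n : ZMod q₂)) := by intro n; simp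
  have hc₁ : ((c : ℕ) : ZMod q₁) = 0 :=
    (ZMod.natCast_eq_zero_iff _ _).mpr ((dvd_mul_right _ _).trans hqc)
  have hc₂ : ((c : ℕ) : ZMod q₂) = 0 :=
    (ZMod.natCast_eq_zero_iff _ _).mpr ((dvd_mul_left _ _).trans hqc)
  have hpc₁ : ∀ n, χ₁ ((n + c : ℕ) : ZMod q₁) = χ₁ (n : ZMod q₁) := by
    intro n; push_cast; rw [hc₁, add_zero]
  have hpc₂ : ∀ n, (starRingEnd ℂ) (χ₂ ((n + c : ℕ) : ZMod q₂)) =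
    (starRingEnd ℂ) (χ₂ (n : ZMod q₂)) := by intro n; push_cast; rw [hc₂, add_zero]
  have hv₂ : ∀ l : ℕ, χ₁ (l : ZMod q₁) ≠ 0 →
      ∑ b ∈ Finset.range c, (starRingEnd ℂ) (χ₂ (b : ZMod q₂)) * ζ ^ (b * l) = 0 := by
    intro l hl
    refine char_sum_zero (fun b : ℕ => (starRingEnd ℂ) (χ₂ (b : ZMod q₂))) q₂ c hp₂ hpc₂ ζ hζ l ?_
    intro h
    refine hl (hχ₁0 l ?_)
    have := hqc.trans h
    rw [mul_comm q₁ q₂] at this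
    exact Nat.dvd_of_mul_dvd_mul_left (by omega) this
  have hv₁ : ∀ b : ℕ, (starRingEnd ℂ) (χ₂ (b : ZMod q₂)) ≠ 0 →
      ∑ l ∈ Finset.range c, χ₁ (l : ZMod q₁) * ζ ^ (l * b) = 0 := by
    intro b hb
    refine char_sum_zero (fun b : ℕ => χ₁ (b : ZMod q₁)) q₁ c hp₁ hpc₁ ζ hζ b ?_
    intro h
    refine hb ?_
    rw [hχ₂0 b (Nat.dvd_of_mul_dvd_mul_left (by omega) (hqc.trans h)), map_zero]
  obtain ⟨T, hT⟩ : ∃ T : ℕ → ℕ → ℂ, ∀ b l, T b l = χ₁ (l : ZMod q₁) *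
    ∑ i ∈ Finset.range (b+1), (starRingEnd ℂ) (χ₂ (i : ZMod q₂)) * ζ ^ (i * l) := ⟨_, fun _ _ => rfl⟩
  have hζc : ∀ n, ζ ^ (n * c) = 1 := fun n => by rw [mul_comm, pow_mul, hζ.pow_eq_one, one_pow]
  have hTK : ∀ b, ∃ K : ℝ, 0 ≤ K ∧ ∀ n, ‖∑ l ∈ Finset.range n, T b l‖ ≤ K := by
    intro b
    refine bdd_partial _ c hc ?_ ?_
    · intro n
      simp only [hT, hpc₁, mul_add, pow_add, hζc, mul_one]
    · simp only [hT, Finset.mul_sum]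
      rw [Finset.sum_comm]
      refine Finset.sum_eq_zero fun i _ => ?_
      by_cases hi : (starRingEnd ℂ) (χ₂ (i : ZMod q₂)) = 0
      · simp [hi]
      · have := hv₁ i hi
        calc _ = (starRingEnd ℂ) (χ₂ (i : ZMod q₂)) *
              ∑ l ∈ Finset.range c, χ₁ (l : ZMod q₁) * ζ ^ (l * i) := by
              rw [Finset.mul_sum]
              refine Finset.sum_congr rfl fun l _ => ?_
              rw [mul_comm l i]; ring
          _ = 0 := by rw [this, mul_zero]
  choose K hK0 hK using hTK
  have hLip : ∀ b : ℕ, ∃ L : ℝ, b < c → 0 ≤ L ∧ ∀ x y : ℝ, 0 ≤ y → y ≤ x → x ≤ 1 →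
      |phi c b x - phi c b y| ≤ L * (x - y) := by
    intro b
    by_cases hb : b < c
    · obtain ⟨L, h⟩ := phi_lip c b hb
      exact ⟨L, fun _ => h⟩
    · exact ⟨0, fun h => absurd h hb⟩
  choose L hL using hLip
  -- rewriting of a single term
  have hterm : ∀ u : ℝ, 0 < u → ∀ l : ℕ, 1 ≤ l →
      χ₁ ((l : ℕ) : ZMod q₁) / (l : ℂ) *
              ∑' k : ℕ+, (starRingEnd ℂ) (χ₂ ((k : ℕ) : ZMod q₂)) *
                eC ((k : ℂ) * (l : ℂ) * ((a : ℂ) / (c : ℂ) + Complex.I * (u : ℂ)))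
      = ∑ b ∈ Finset.range c, T b l * ((phi c b (Real.exp (-2 * Real.pi * u) ^ l) / l : ℝ) : ℂ) := by
    intro u hu l hl
    by_cases h1 : χ₁ (l : ZMod q₁) = 0
    · simp [hT, h1]
    have hr1 : Real.exp (-2 * Real.pi * u) < 1 := by
      rw [Real.exp_lt_one_iff]
      have := Real.pi_pos
      nlinarith [mul_pos this hu]
    obtain ⟨x, hx⟩ : ∃ x : ℝ, x = Real.exp (-2 * Real.pi * u) ^ l := ⟨_, rfl⟩
    have hx0 : 0 < x := by rw [hx]; positivity
    have hx1 : x < 1 := by rw [hx]; exact pow_lt_one₀ (Real.exp_pos _).le hr1 (by omega)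
    have he : ∀ k : ℕ, eC ((k : ℂ) * (l : ℂ) * ((a : ℂ) / (c : ℂ) + Complex.I * (u : ℂ)))
        = ζ ^ (k * l) * (x : ℂ) ^ k := by
      intro k
      rw [hζdef, hx]
      unfold eC
      push_cast
      rw [← Complex.exp_nat_mul, ← Complex.exp_nat_mul, ← Complex.exp_nat_mul, ← Complex.exp_add]
      congr 1
      push_cast
      linear_combination (2 * Real.pi * k * l * u : ℂ) * Complex.I_sq
    have ht : ∑' k : ℕ+, (starRingEnd ℂ) (χ₂ ((k : ℕ) : ZMod q₂)) *
                eC ((k : ℂ) * (l : ℂ) * ((a : ℂ) / (c : ℂ) + Complex.I * (u : ℂ)))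
        = ∑' k : ℕ, (starRingEnd ℂ) (χ₂ (k : ZMod q₂)) * ζ ^ (k * l) * (x : ℂ) ^ k := by
      have h2 := tsum_subtype_eq_of_support_subset (s := {n : ℕ | 0 < n})
        (f := fun k : ℕ => (starRingEnd ℂ) (χ₂ (k : ZMod q₂)) * ζ ^ (k * l) * (x : ℂ) ^ k) (by
          intro k hk
          rcases Nat.eq_zero_or_pos k with h | h
          · exfalso; apply hk
            have := hχ₂0 k (by rw [h]; exact dvd_zero _)
            simp only [this, map_zero, zero_mul]
          · exact h)
      rw [← h2]
      refine tsum_congr fun k => ?_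
      have := he (k : ℕ)
      refine Eq.trans ?_ (mul_assoc _ _ _).symm
      exact congrArg ((starRingEnd ℂ) (χ₂ ((k : ℕ) : ZMod q₂)) * ·) this
    rw [ht, tsum_periodic (fun k : ℕ => (starRingEnd ℂ) (χ₂ (k : ZMod q₂)) * ζ ^ (k * l)) c hc ?_ ?_
      (hv₂ l h1) x hx0 hx1, Finset.mul_sum, ← hx]
    · refine Finset.sum_congr rfl fun b _ => ?_
      rw [hT]
      push_cast
      ring
    · intro n
      simp only [hpc₂, add_mul, pow_add, mul_comm c l, hζc, mul_one]
    · intro n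
      have : ‖ζ‖ = 1 := hζ.norm'_eq_one hc0
      rw [norm_mul, norm_pow, this, one_pow, mul_one, RCLike.norm_conj]
      exact χ₂.norm_le_one _
  -- Cauchy estimate
  obtain ⟨M, hM⟩ : ∃ M : ℝ, M = ∑ b ∈ Finset.range c, K b * (3 + L b) := ⟨_, rfl⟩
  have hM0 : 0 ≤ M := by
    rw [hM]
    refine Finset.sum_nonneg fun b hb => mul_nonneg (hK0 b) ?_
    have := (hL b (Finset.mem_range.mp hb)).1
    linarith
  have hbound : ∀ u : ℝ, 0 < u → ∀ m n : ℕ, 1 ≤ m → m ≤ n →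
      ‖∑ l ∈ Finset.Ico m n, (χ₁ ((l : ℕ) : ZMod q₁) / (l : ℂ) *
              ∑' k : ℕ+, (starRingEnd ℂ) (χ₂ ((k : ℕ) : ZMod q₂)) *
                eC ((k : ℂ) * (l : ℂ) * ((a : ℂ) / (c : ℂ) + Complex.I * (u : ℂ))))‖ ≤ M / m := by
    intro u hu m n hm hmn
    rw [Finset.sum_congr rfl fun l hl => hterm u hu l (hm.trans (Finset.mem_Ico.mp hl).1),
      Finset.sum_comm, hM, Finset.sum_div]
    refine (norm_sum_le _ _).trans (Finset.sum_le_sum fun b hb => ?_)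
    have hb' := Finset.mem_range.mp hb
    refine block_bound (T b) (K b) (hK0 b) (hK b) (phi c b) (L b) (hL b hb').1 (phi_nonneg c b)
      (phi_le c b hb') (hL b hb').2 _ (Real.exp_pos _).le ?_ m n hm hmn
    rw [Real.exp_le_one_iff]
    have := Real.pi_pos
    nlinarith [mul_pos this hu]
  obtain ⟨S, hS⟩ : ∃ S : ℕ → ℝ → ℂ, S = (fun (N : ℕ) (u : ℝ) =>
          ∑ l ∈ Finset.Icc 1 N,
            χ₁ ((l : ℕ) : ZMod q₁) / (l : ℂ) *
              ∑' k : ℕ+, (starRingEnd ℂ) (χ₂ ((k : ℕ) : ZMod q₂)) *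
                eC ((k : ℂ) * (l : ℂ) * ((a : ℂ) / (c : ℂ) + Complex.I * (u : ℂ)))) := ⟨_, rfl⟩
  rw [← hS]
  have hdist : ∀ u : ℝ, 0 < u → ∀ m n : ℕ, m ≤ n → dist (S m u) (S n u) ≤ M / (m + 1 : ℕ) := by
    intro u hu m n hmn
    have := hbound u hu (m+1) (n+1) (by omega) (by omega)
    rw [dist_comm, dist_eq_norm, hS]
    simp only
    rw [← Finset.Ico_succ_right_eq_Icc, ← Finset.Ico_succ_right_eq_Icc]
    simp only [Nat.succ_eq_succ, Nat.succ_eq_add_one]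
    rw [← Finset.sum_Ico_consecutive _ (by omega : 1 ≤ m + 1) (by omega : m + 1 ≤ n + 1),
      add_sub_cancel_left]
    exact this
  have hcau : UniformCauchySeqOn S Filter.atTop (Set.Ioi 0) := by
    rw [Metric.uniformCauchySeqOn_iff]
    intro ε hε
    obtain ⟨N, hN⟩ := exists_nat_gt (M / ε)
    have key : ∀ m, N ≤ m → M / (m + 1 : ℕ) < ε := by
      intro m hm
      have : (N:ℝ) ≤ m := by exact_mod_cast hm
      rw [div_lt_iff₀ hε] at hN
      rw [div_lt_iff₀ (by positivity)]
      push_cast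
      nlinarith
    refine ⟨N, fun m hm n hn u hu => ?_⟩
    rcases le_total m n with h | h
    · exact (hdist u hu m n h).trans_lt (key m hm)
    · rw [dist_comm]
      exact (hdist u hu n m h).trans_lt (key n hn)
  have hlim : ∀ u : ℝ, ∃ y : ℂ, 0 < u → Filter.Tendsto (fun n => S n u) Filter.atTop (nhds y) := by
    intro u
    by_cases hu : 0 < u
    · obtain ⟨y, hy⟩ := cauchySeq_tendsto_of_complete (hcau.cauchySeq hu)
      exact ⟨y, fun _ => hy⟩
    · exact ⟨0, fun h => absurd h hu⟩
  choose g hg using hlim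
  exact ⟨g, hcau.tendstoUniformlyOn_of_tendsto fun u hu => hg u hu⟩
end

section
/- Let χ₁, χ₂ be primitive Dirichlet characters of conductors q₁, q₂ respectively, with q₁, q₂ > 1 and χ₁(−1)χ₂(−1) = 1, and set δ = χ₂(−1)·τ(χ₁)·q₂/(τ(χ₂)·q₁). Then the function z ↦ f_{χ₁,χ₂}(−1/(q₁q₂·z)) − δ·f_{χ₂,χ₁}(z) is constant on the upper half-plane ℍ. -/
open Complex

lemma sum_range_zmod {q : ℕ} [NeZero q] (g : ZMod q → ℂ) :
    ∑ n ∈ Finset.range q, g (n : ZMod q) = ∑ a : ZMod q, g a := by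
  refine Finset.sum_bij' (fun n _ => (n : ZMod q)) (fun a _ => a.val) ?_ ?_ ?_ ?_ ?_
  · intros; simp
  · intro a _; simpa using ZMod.val_lt a
  · intro n hn; simpa using ZMod.val_cast_of_lt (Finset.mem_range.mp hn)
  · intro a _; simp
  · intros; rfl

lemma eC_stdAddChar {q : ℕ} [NeZero q] (n : ℕ) :
    eC ((n : ℂ) / (q : ℂ)) = ZMod.stdAddChar (n : ZMod q) := by
  have := ZMod.stdAddChar_coe (N := q) (n : ℤ)
  push_cast at this
  rw [this, eC]
  congr 1
  ring

lemma gaussSum'_eq {q : ℕ} [NeZero q] (χ : DirichletCharacter ℂ q) :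
    gaussSum' χ = gaussSum χ (ZMod.stdAddChar (N := q)) := by
  rw [gaussSum', gaussSum, ← sum_range_zmod]
  simp_rw [eC_stdAddChar]

lemma gaussSum'_shift {q : ℕ} [NeZero q] (χ : DirichletCharacter ℂ q) (hχ : χ.IsPrimitive) (k : ℕ) :
    ∑ n ∈ Finset.range q, χ ((n : ℕ) : ZMod q) * eC ((k : ℂ) * (n : ℂ) / (q : ℂ)) =
      (starRingEnd ℂ) (χ (k : ZMod q)) * gaussSum' χ := by
  have h := gaussSum_mulShift_of_isPrimitive (ZMod.stdAddChar (N := q)) hχ (k : ZMod q)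
  rw [gaussSum'_eq]
  have h2 : (starRingEnd ℂ) (χ (k : ZMod q)) = χ⁻¹ (k : ZMod q) := by
    simpa using MulChar.star_apply' χ (k : ZMod q)
  rw [h2, ← h, gaussSum, ← sum_range_zmod]
  refine Finset.sum_congr rfl fun n _ => ?_
  have := eC_stdAddChar (q := q) (k * n)
  push_cast at this
  rw [this, AddChar.mulShift_apply]

lemma gaussSum'_ne_zero {q : ℕ} [NeZero q] (χ : DirichletCharacter ℂ q) (hχ : χ.IsPrimitive) :
    gaussSum' χ ≠ 0 := by
  intro h0
  rw [gaussSum'_eq] at h0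
  have h1 : ZMod.dft (χ : ZMod q → ℂ) = 0 := by
    ext k
    rw [hχ.fourierTransform_eq_inv_mul_gaussSum, h0]
    simp
  have h2 : (χ : ZMod q → ℂ) = 0 := by
    apply (ZMod.dft (N := q) (E := ℂ)).injective
    rw [h1, map_zero]
  have := congrFun h2 1
  simp at this

lemma sum_char_zero {q : ℕ} [NeZero q] (hq : 1 < q) (χ : DirichletCharacter ℂ q)
    (hχ : χ.IsPrimitive) : ∑ a : ZMod q, χ a = 0 := by
  apply MulChar.sum_eq_zero_of_ne_one
  rintro rfl
  have : (1 : DirichletCharacter ℂ q).conductor = q := hχ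
  rw [DirichletCharacter.conductor_one] at this
  omega
  

/-- Partial sums of a character, a periodic function. -/
lemma exists_partial {q : ℕ} [NeZero q] (hq : 1 < q) (χ : DirichletCharacter ℂ q)
    (hχ : χ.IsPrimitive) : ∃ S : ZMod q → ℂ, ∀ a : ZMod q, S a - S (a - 1) = χ a := by
  refine ⟨fun a => ∑ j ∈ Finset.range (a.val + 1), χ (j : ZMod q), fun a => ?_⟩
  by_cases ha : a = 0
  · subst ha
    have h : ((0 : ZMod q) - 1).val + 1 = q := by
      obtain ⟨n, rfl⟩ : ∃ n, q = n + 1 := ⟨q - 1, by omega⟩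
      rw [zero_sub, ZMod.val_neg_one]
    simp only [h, sum_range_zmod (fun a => χ a), sum_char_zero hq χ hχ]
    simp
  · have h : (a - 1).val + 1 = a.val := by
      have : Fact (1 < q) := ⟨hq⟩
      rw [ZMod.val_sub, ZMod.val_one]
      · have := (ZMod.val_ne_zero a).2 ha
        omega
      · have := (ZMod.val_ne_zero a).2 ha
        rw [ZMod.val_one]; omega
    simp only [h, Finset.sum_range_succ]
    simp

lemma eC_add (a b : ℂ) : eC (a + b) = eC a * eC b := by
  simp only [eC, mul_add, Complex.exp_add]

lemma eC_nat_mul (n : ℕ) (w : ℂ) : eC ((n : ℂ) * w) = eC w ^ n := by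
  simp only [eC]
  rw [← Complex.exp_nat_mul]
  congr 1
  ring

lemma norm_eC (w : ℂ) : ‖eC w‖ = Real.exp (-(2 * Real.pi * w.im)) := by
  simp [eC, Complex.norm_exp]

lemma norm_eC_lt {w : ℂ} (hw : 0 < w.im) : ‖eC w‖ < 1 := by
  rw [norm_eC, Real.exp_lt_one_iff]
  have := Real.pi_pos
  have : 0 < 2 * Real.pi * w.im := by positivity
  linarith

lemma eC_kl (k l : ℕ) (z : ℂ) : eC ((k : ℂ) * l * z) = eC z ^ (l * k) := by
  rw [← eC_nat_mul]; congr 1; push_cast; ring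

lemma summable_kl {z : ℂ} (hz : 0 < z.im) :
    Summable fun c : ℕ+ × ℕ+ => ((c.2 : ℕ) : ℝ) * ‖eC (((c.2 : ℕ) : ℂ) * ((c.1 : ℕ) : ℂ) * z)‖ := by
  have h := (summable_prod_mul_pow (𝕜 := ℂ) 1 (norm_eC_lt hz)).norm
  refine h.congr fun c => ?_
  rw [eC_kl]
  simp

/-- `∑_k conj χ(k) k e(kw)`. -/
noncomputable def Lq {q : ℕ} (χ : DirichletCharacter ℂ q) (w : ℂ) : ℂ :=
  ∑' k : ℕ+, (starRingEnd ℂ) (χ ((k : ℕ) : ZMod q)) * ((k : ℕ) : ℂ) * eC (((k : ℕ) : ℂ) * w)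

/-- `∑_d χ(d) (w+d)^{-2}`. -/
noncomputable def Pq {q : ℕ} (χ : DirichletCharacter ℂ q) (w : ℂ) : ℂ :=
  ∑' d : ℤ, χ ((d : ℤ) : ZMod q) * ((w + d) ^ 2)⁻¹

lemma summable_P {q : ℕ} (g : ZMod q → ℂ) (C : ℝ) (hg : ∀ a, ‖g a‖ ≤ C) (w : ℂ) :
    Summable fun d : ℤ => g ((d : ℤ) : ZMod q) * ((w + d) ^ 2)⁻¹ := by
  have h := (EisensteinSeries.linear_right_summable w 1 (k := 2) le_rfl).norm.mul_left C
  refine Summable.of_norm_bounded h fun d => ?_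
  rw [norm_mul]
  simp only [Int.cast_one, one_mul]
  exact mul_le_mul_of_nonneg_right (hg _) (norm_nonneg _)

lemma Pq_neg {q : ℕ} (χ : DirichletCharacter ℂ q) (w : ℂ) : Pq χ (-w) = χ (-1) * Pq χ w := by
  rw [Pq, Pq, ← tsum_mul_left, ← (Equiv.neg ℤ).tsum_eq]
  refine tsum_congr fun d => ?_
  simp only [Equiv.neg_apply, Int.cast_neg]
  rw [show -w + -(d : ℂ) = -(w + d) by ring, neg_sq, ← neg_one_mul, map_mul, mul_assoc]

lemma lipschitz {w : ℂ} (hw : 0 < w.im) :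
    ∑' n : ℤ, ((w + n) ^ 2)⁻¹ =
      -4 * (Real.pi : ℂ) ^ 2 * ∑' k : ℕ+, ((k : ℕ) : ℂ) * eC (((k : ℕ) : ℂ) * w) := by
  have h := EisensteinSeries.qExpansion_identity_pnat (k := 1) le_rfl ⟨w, hw⟩
  simp only [one_div, Nat.reduceAdd, pow_one] at h
  simp_rw [eC_nat_mul]
  refine Eq.trans h ?_
  congr 1
  have : (Complex.I) ^ 2 = -1 := Complex.I_sq
  simp [mul_pow]
  ring

lemma summable_k {w : ℂ} (hw : 0 < w.im) :
    Summable fun k : ℕ+ => ((k : ℕ) : ℂ) * eC (((k : ℕ) : ℂ) * w) := by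
  have h := (summable_kl hw).comp_injective (i := fun k : ℕ+ => ((1 : ℕ+), k))
    (fun a b h => by simpa using h)
  refine Summable.of_norm (h.congr fun k => ?_)
  simp

lemma Pq_eq {q : ℕ} [NeZero q] (χ : DirichletCharacter ℂ q) (hχ : χ.IsPrimitive) {w : ℂ}
    (hw : 0 < w.im) :
    Pq χ w = -4 * (Real.pi : ℂ) ^ 2 / (q : ℂ) ^ 2 * gaussSum' χ * Lq χ (w / q) := by
  have hq : (q : ℂ) ≠ 0 := by exact_mod_cast NeZero.ne q
  have hqr : (0 : ℝ) < q := by exact_mod_cast Nat.pos_of_ne_zero (NeZero.ne q)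
  have hs := summable_P (fun a => χ a) 1 (fun a => DirichletCharacter.norm_le_one χ a) w
  have him (a : ℕ) : 0 < ((w + a) / q).im := by
    have : ((w + a) / (q : ℂ)).im = w.im / q := by
      rw [← Complex.ofReal_natCast q, Complex.div_ofReal_im]; simp
    rw [this]; positivity
  set e : Fin q × ℤ ≃ ℤ := (Equiv.prodComm _ _).trans (Int.divModEquiv q).symm with he
  have hea (p : Fin q × ℤ) : e p = p.2 * q + (p.1 : ℕ) := by simp [he]
  have h1 : Pq χ w = ∑ a ∈ Finset.range q, χ (a : ZMod q) * ((q : ℂ) ^ 2)⁻¹ *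
      ∑' n : ℤ, (((w + a) / q + n) ^ 2)⁻¹ := by
    have hs' : Summable fun p : Fin q × ℤ =>
        χ ((e p : ℤ) : ZMod q) * ((w + ((e p : ℤ) : ℂ)) ^ 2)⁻¹ :=
      (e.summable_iff (f := fun d : ℤ => χ (d : ZMod q) * ((w + d) ^ 2)⁻¹)).mpr hs
    rw [Pq, ← e.tsum_eq, hs'.tsum_prod, tsum_fintype,
      ← Fin.sum_univ_eq_sum_range (fun a => χ (a : ZMod q) * ((q : ℂ) ^ 2)⁻¹ *
      ∑' n : ℤ, (((w + a) / q + n) ^ 2)⁻¹)]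
    refine Finset.sum_congr rfl fun a _ => ?_
    rw [← tsum_mul_left]
    refine tsum_congr fun n => ?_
    rw [hea]
    push_cast
    rw [ZMod.natCast_self, mul_zero, zero_add, mul_assoc, ← mul_inv, ← mul_pow]
    congr 4
    field_simp
    ring
  rw [h1]
  have h2 (a : ℕ) : χ (a : ZMod q) * ((q : ℂ) ^ 2)⁻¹ * ∑' n : ℤ, (((w + a) / q + n) ^ 2)⁻¹ =
      -4 * (Real.pi : ℂ) ^ 2 / (q : ℂ) ^ 2 * ∑' k : ℕ+, χ (a : ZMod q) *
        (((k : ℕ) : ℂ) * eC (((k : ℕ) : ℂ) * ((w + a) / q))) := by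
    rw [lipschitz (him a), tsum_mul_left]; ring
  simp_rw [h2]
  rw [← Finset.mul_sum, mul_assoc, ← Summable.tsum_finsetSum
    (fun a _ => (summable_k (him a)).mul_left _), Lq, ← tsum_mul_left (a := gaussSum' χ)]
  congr 1
  refine tsum_congr fun k => ?_
  have := gaussSum'_shift χ hχ k
  rw [show gaussSum' χ * ((starRingEnd ℂ) (χ ((k : ℕ) : ZMod q)) * ((k : ℕ) : ℂ) *
    eC (((k : ℕ) : ℂ) * (w / q))) = ((starRingEnd ℂ) (χ ((k : ℕ) : ZMod q)) * gaussSum' χ) *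
      (((k : ℕ) : ℂ) * eC (((k : ℕ) : ℂ) * (w / q))) by ring, ← this, Finset.sum_mul]
  refine Finset.sum_congr rfl fun a _ => ?_
  rw [show ((k : ℕ) : ℂ) * ((w + a) / q) = (k : ℕ) * (a : ℂ) / q + (k : ℕ) * (w / q) by ring, eC_add]
  ring

lemma summable_char_kl {q : ℕ} (χ : DirichletCharacter ℂ q) {z : ℂ} (hz : 0 < z.im) :
    Summable fun c : ℕ+ × ℕ+ => (starRingEnd ℂ) (χ ((c.2 : ℕ) : ZMod q)) * ((c.2 : ℕ) : ℂ) *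
      eC (((c.2 : ℕ) : ℂ) * (((c.1 : ℕ) : ℂ) * z)) := by
  refine Summable.of_norm_bounded (summable_kl hz) fun c => ?_
  rw [norm_mul, norm_mul, RCLike.norm_conj, mul_assoc _ _ z]
  refine mul_le_mul_of_nonneg_right ?_ (norm_nonneg _)
  simpa using mul_le_mul_of_nonneg_right (DirichletCharacter.norm_le_one χ ((c.2 : ℕ) : ZMod q))
    (Nat.cast_nonneg (α := ℝ) (c.2 : ℕ))

lemma summable_Lq {q : ℕ} (χ : DirichletCharacter ℂ q) {z : ℂ} (hz : 0 < z.im) :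
    Summable fun l : ℕ+ => Lq χ (((l : ℕ) : ℂ) * z) :=
  (summable_char_kl χ hz).prod

lemma summable_Pq {q : ℕ} [NeZero q] (χ : DirichletCharacter ℂ q) (hχ : χ.IsPrimitive) {t : ℂ}
    (ht : 0 < t.im) : Summable fun d : ℤ => Pq χ ((d : ℂ) * t) := by
  have hqr : (0 : ℝ) < q := by exact_mod_cast Nat.pos_of_ne_zero (NeZero.ne q)
  have him : 0 < (t / q).im := by
    have : (t / (q : ℂ)).im = t.im / q := by
      rw [← Complex.ofReal_natCast q, Complex.div_ofReal_im]
    rw [this]; positivity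
  have h1 : Summable fun l : ℕ+ => Pq χ (((l : ℕ) : ℂ) * t) := by
    refine ((summable_Lq χ him).mul_left
      (-4 * (Real.pi : ℂ) ^ 2 / (q : ℂ) ^ 2 * gaussSum' χ)).congr fun l => ?_
    have hl : 0 < (((l : ℕ) : ℂ) * t).im := by simpa using ht
    rw [Pq_eq χ hχ hl, mul_div_assoc ((l : ℕ) : ℂ)]
  have h2 : Summable fun n : ℕ => Pq χ ((n : ℂ) * t) := by
    rw [← summable_nat_add_iff 1]
    exact (summable_pnat_iff_summable_succ (f := fun n : ℕ => Pq χ ((n : ℂ) * t))).mp h1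
  refine Summable.of_nat_of_neg (by simpa using h2) ?_
  simp only [Int.cast_neg, Int.cast_natCast, neg_mul, Pq_neg]
  exact h2.mul_left _

lemma inv_sq_diff {A B : ℂ} (hA : A ≠ 0) (hB : B ≠ 0) (h : ‖B - A‖ = 1) :
    ‖(A ^ 2)⁻¹ - (B ^ 2)⁻¹‖ ≤ ‖A‖⁻¹ ^ 3 + ‖B‖⁻¹ ^ 3 := by
  have e : (A ^ 2)⁻¹ - (B ^ 2)⁻¹ = (B - A) * A⁻¹ * B⁻¹ * (A⁻¹ + B⁻¹) := by
    field_simp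
    ring
  rw [e, norm_mul, norm_mul, norm_mul, h]
  have h1 : ‖A⁻¹ + B⁻¹‖ ≤ ‖A‖⁻¹ + ‖B‖⁻¹ := by
    simpa [norm_inv] using norm_add_le A⁻¹ B⁻¹
  rw [norm_inv, norm_inv, one_mul]
  have ha : 0 ≤ ‖A‖⁻¹ := by positivity
  have hb : 0 ≤ ‖B‖⁻¹ := by positivity
  generalize ‖A‖⁻¹ = a at *
  generalize ‖B‖⁻¹ = b at *
  calc a * b * ‖A⁻¹ + B⁻¹‖ ≤ a * b * (a + b) := by gcongr
    _ ≤ a ^ 3 + b ^ 3 := by nlinarith [mul_nonneg (add_nonneg ha hb) (sq_nonneg (a - b))]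

lemma summable_lattice {α : ℂ} (hα : 0 < α.im) :
    Summable fun p : ℤ × ℤ => ‖(p.1 : ℂ) * α + p.2‖⁻¹ ^ 3 := by
  have h := (EisensteinSeries.summable_one_div_norm_rpow (k := 3) (by norm_num)).mul_left
    (EisensteinSeries.r ⟨α, hα⟩ ^ (-(3 : ℝ)))
  have h2 := ((finTwoArrowEquiv ℤ).symm.summable_iff).mpr h
  refine Summable.of_nonneg_of_le (fun p => by positivity) (fun p => ?_) h2
  have := EisensteinSeries.summand_bound ⟨α, hα⟩ (k := 3) (by norm_num) ![p.1, p.2]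
  simp only [Matrix.cons_val_zero, Matrix.cons_val_one] at this
  refine le_trans (le_of_eq ?_) this
  rw [Real.rpow_neg (norm_nonneg _), inv_pow]
  norm_cast

lemma lattice_ne {α : ℂ} (hα : 0 < α.im) {c : ℤ} (hc : c ≠ 0) (d : ℤ) : (c : ℂ) * α + d ≠ 0 := by
  intro h
  have := congrArg Complex.im h
  simp at this
  rcases this with h | h
  · exact hc h
  · exact hα.ne' h

lemma char_zero {q : ℕ} (hq : 1 < q) (χ : DirichletCharacter ℂ q) : χ 0 = 0 := by
  have : Fact (1 < q) := ⟨hq⟩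
  exact MulChar.map_zero χ

lemma summable_exchange {q₁ q₂ : ℕ} (hq₁ : 1 < q₁)
    (χ₁ : DirichletCharacter ℂ q₁) (S : ZMod q₂ → ℂ) (C : ℝ) (hS : ∀ a, ‖S a‖ ≤ C)
    {α : ℂ} (hα : 0 < α.im) :
    Summable fun p : ℤ × ℤ => χ₁ (p.1 : ZMod q₁) * (S (p.2 : ZMod q₂) *
      ((((p.1 : ℂ) * α + p.2) ^ 2)⁻¹ - (((p.1 : ℂ) * α + (p.2 + 1 : ℤ)) ^ 2)⁻¹)) := by
  have hl := summable_lattice hα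
  let e : ℤ × ℤ ≃ ℤ × ℤ := (Equiv.refl ℤ).prodCongr (Equiv.addRight (1 : ℤ))
  have hl2 : Summable fun p : ℤ × ℤ => ‖(p.1 : ℂ) * α + (p.2 + 1 : ℤ)‖⁻¹ ^ 3 :=
    e.summable_iff.mpr hl
  refine Summable.of_norm_bounded ((hl.add hl2).mul_left C) fun p => ?_
  have hC : 0 ≤ C := (norm_nonneg _).trans (hS 0)
  by_cases hc : p.1 = 0
  · rw [hc, Int.cast_zero, char_zero hq₁, zero_mul, norm_zero]
    positivity
  · rw [norm_mul, norm_mul]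
    have h1 := DirichletCharacter.norm_le_one χ₁ (p.1 : ZMod q₁)
    have h2 := inv_sq_diff (lattice_ne hα hc p.2) (lattice_ne hα hc (p.2 + 1)) (by
      push_cast
      rw [show (p.1 : ℂ) * α + (p.2 + 1) - (p.1 * α + p.2) = 1 by ring, norm_one])
    calc _ ≤ 1 * (C * _) := by
          gcongr
          exact hS _
      _ ≤ _ := by rw [one_mul]; gcongr

lemma abel_shift {q : ℕ} (χ : DirichletCharacter ℂ q) (S : ZMod q → ℂ)
    (hS : ∀ a : ZMod q, S a - S (a - 1) = χ a) (u : ℤ → ℂ)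
    (h1 : Summable fun d : ℤ => S (d : ZMod q) * u d)
    (h2 : Summable fun d : ℤ => S (d : ZMod q) * u (d + 1)) :
    ∑' d : ℤ, S (d : ZMod q) * (u d - u (d + 1)) = ∑' d : ℤ, χ (d : ZMod q) * u d := by
  simp_rw [mul_sub]
  have e2 : ∑' d : ℤ, S (d : ZMod q) * u (d + 1) = ∑' d : ℤ, S ((d : ZMod q) - 1) * u d := by
    rw [← (Equiv.addRight (1 : ℤ)).tsum_eq (fun d : ℤ => S ((d : ZMod q) - 1) * u d)]
    refine tsum_congr fun d => ?_
    simp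
  have h3 : Summable fun d : ℤ => S ((d : ZMod q) - 1) * u d := by
    rw [← (Equiv.addRight (1 : ℤ)).summable_iff]
    refine h2.congr fun d => ?_
    simp
  rw [h1.tsum_sub h2, e2, ← h1.tsum_sub h3]
  refine tsum_congr fun d => ?_
  rw [← hS]; ring

lemma neg_inv_im {t : ℂ} (ht : 0 < t.im) : 0 < (-1 / t).im := by
  have h0 : t ≠ 0 := by rintro rfl; simp at ht
  have := Complex.normSq_pos.mpr h0
  simp [neg_div, Complex.inv_im]
  positivity

lemma hasSum_K {q : ℕ} (χ : DirichletCharacter ℂ q) {t : ℂ} (ht : t ≠ 0) (d : ℤ) :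
    HasSum (fun c : ℤ => χ (c : ZMod q) * (((c : ℂ) * (-1 / t) + d) ^ 2)⁻¹)
      (t ^ 2 * χ (-1) * Pq χ ((d : ℂ) * t)) := by
  have h := (summable_P (fun a => χ a) 1
    (fun a => DirichletCharacter.norm_le_one χ a) ((d : ℂ) * t)).hasSum.mul_left (t ^ 2 * χ (-1))
  rw [← (Equiv.neg ℤ).hasSum_iff] at h
  rw [Pq]
  refine (congrArg (fun F => HasSum F _) (funext fun c => ?_)).mpr h
  simp only [Function.comp, Equiv.neg_apply, Int.cast_neg]
  rw [← neg_one_mul (c : ZMod q), map_mul]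
  have hsq : χ (-1) * χ (-1) = 1 := by rw [← map_mul]; simp
  have : (c : ℂ) * (-1 / t) + d = (d * t + -c) / t := by field_simp; ring
  rw [this, div_pow, inv_div, div_eq_mul_inv]
  linear_combination (-(χ (c : ZMod q)) * (t ^ 2 * ((d * t + -c) ^ 2)⁻¹)) * hsq

lemma exchange {q₁ q₂ : ℕ} [NeZero q₁] [NeZero q₂] (hq₁ : 1 < q₁) (hq₂ : 1 < q₂)
    (χ₁ : DirichletCharacter ℂ q₁) (χ₂ : DirichletCharacter ℂ q₂)
    (hχ₁ : χ₁.IsPrimitive) (hχ₂ : χ₂.IsPrimitive) {t : ℂ} (ht : 0 < t.im) :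
    ∑' c : ℤ, χ₁ (c : ZMod q₁) * Pq χ₂ ((c : ℂ) * (-1 / t)) =
      t ^ 2 * χ₁ (-1) * ∑' d : ℤ, χ₂ (d : ZMod q₂) * Pq χ₁ ((d : ℂ) * t) := by
  obtain ⟨S, hS⟩ := exists_partial hq₂ χ₂ hχ₂
  have h0 : t ≠ 0 := by rintro rfl; simp at ht
  obtain ⟨C, hC⟩ : ∃ C : ℝ, ∀ a, ‖S a‖ ≤ C :=
    ⟨∑ a, ‖S a‖, fun a => Finset.single_le_sum (f := fun a => ‖S a‖)
      (fun _ _ => norm_nonneg _) (Finset.mem_univ a)⟩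
  have hα := neg_inv_im ht
  have hsum := summable_exchange hq₁ χ₁ S C hC hα
  have hcomm := Summable.tsum_comm (f := fun c d : ℤ => χ₁ (c : ZMod q₁) * (S (d : ZMod q₂) *
      ((((c : ℂ) * (-1 / t) + d) ^ 2)⁻¹ - (((c : ℂ) * (-1 / t) + (d + 1 : ℤ)) ^ 2)⁻¹))) hsum
  have hL (c : ℤ) : ∑' d : ℤ, χ₁ (c : ZMod q₁) * (S (d : ZMod q₂) *
      ((((c : ℂ) * (-1 / t) + d) ^ 2)⁻¹ - (((c : ℂ) * (-1 / t) + (d + 1 : ℤ)) ^ 2)⁻¹)) =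
      χ₁ (c : ZMod q₁) * Pq χ₂ ((c : ℂ) * (-1 / t)) := by
    rw [tsum_mul_left, abel_shift χ₂ S hS (fun d : ℤ => (((c : ℂ) * (-1 / t) + d) ^ 2)⁻¹), Pq]
    · exact summable_P S C hC _
    · refine (summable_P S C hC ((c : ℂ) * (-1 / t) + 1)).congr fun d => ?_
      push_cast
      congr 3
      ring
  set K : ℤ → ℂ := fun d => t ^ 2 * χ₁ (-1) * Pq χ₁ ((d : ℂ) * t) with hK
  have hKs : Summable K := (summable_Pq χ₁ hχ₁ ht).mul_left _
  have hKs2 : Summable fun d => K (d + 1) := (Equiv.addRight (1 : ℤ)).summable_iff.mpr hKs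
  have hbd (u : ℤ → ℂ) (hu : Summable u) : Summable fun d : ℤ => S (d : ZMod q₂) * u d := by
    refine Summable.of_norm_bounded (hu.norm.mul_left C) fun d => ?_
    rw [norm_mul]
    exact mul_le_mul_of_nonneg_right (hC _) (norm_nonneg _)
  have hR (d : ℤ) : ∑' c : ℤ, χ₁ (c : ZMod q₁) * (S (d : ZMod q₂) *
      ((((c : ℂ) * (-1 / t) + d) ^ 2)⁻¹ - (((c : ℂ) * (-1 / t) + (d + 1 : ℤ)) ^ 2)⁻¹)) =
      S (d : ZMod q₂) * (K d - K (d + 1)) := by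
    have := ((hasSum_K χ₁ h0 d).sub (hasSum_K χ₁ h0 (d + 1))).mul_left (S (d : ZMod q₂))
    rw [← this.tsum_eq]
    refine tsum_congr fun c => ?_
    ring
  simp_rw [hL, hR] at hcomm
  rw [← hcomm, abel_shift χ₂ S hS K (hbd K hKs) (hbd _ hKs2), ← tsum_mul_left]
  refine tsum_congr fun d => ?_
  simp only [hK]; ring

/-- `∑_l χ₁(l) ∑_k conj χ₂(k) k e(klw)`. -/
noncomputable def Gq {q₁ q₂ : ℕ} (χ₁ : DirichletCharacter ℂ q₁) (χ₂ : DirichletCharacter ℂ q₂)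
    (w : ℂ) : ℂ := ∑' l : ℕ+, χ₁ ((l : ℕ) : ZMod q₁) * Lq χ₂ (((l : ℕ) : ℂ) * w)

lemma fold {q₁ q₂ : ℕ} [NeZero q₁] [NeZero q₂] (hq₁ : 1 < q₁)
    (χ₁ : DirichletCharacter ℂ q₁) (χ₂ : DirichletCharacter ℂ q₂)
    (hχ₂ : χ₂.IsPrimitive) (hpar : χ₁ (-1) * χ₂ (-1) = 1) {t : ℂ} (ht : 0 < t.im) :
    ∑' c : ℤ, χ₁ (c : ZMod q₁) * Pq χ₂ ((c : ℂ) * t) =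
      2 * (-4 * (Real.pi : ℂ) ^ 2 / (q₂ : ℂ) ^ 2 * gaussSum' χ₂ * Gq χ₁ χ₂ (t / q₂)) := by
  rw [tsum_int_eq_zero_add_two_mul_tsum_pnat
    (f := fun c : ℤ => χ₁ (c : ZMod q₁) * Pq χ₂ ((c : ℂ) * t))]
  · rw [Int.cast_zero, char_zero hq₁, zero_mul, zero_add, two_nsmul, ← two_mul]
    congr 1
    rw [Gq, ← tsum_mul_left]
    refine tsum_congr fun l => ?_
    have hl : 0 < (((l : ℕ) : ℂ) * t).im := by simpa using ht
    simp only [Int.cast_natCast]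
    rw [Pq_eq χ₂ hχ₂ hl, mul_div_assoc ((l : ℕ) : ℂ)]
    ring
  · intro c
    simp only [Int.cast_neg, neg_mul, Pq_neg]
    rw [← neg_one_mul (c : ZMod q₁), map_mul]
    linear_combination (χ₁ (c : ZMod q₁) * Pq χ₂ (c * t)) * hpar
  · refine Summable.of_norm_bounded (summable_Pq χ₂ hχ₂ ht).norm fun d => ?_
    rw [norm_mul]
    exact mul_le_of_le_one_left (norm_nonneg _) (DirichletCharacter.norm_le_one χ₁ _)

lemma Gq_fricke {q₁ q₂ : ℕ} [NeZero q₁] [NeZero q₂] (hq₁ : 1 < q₁) (hq₂ : 1 < q₂)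
    (χ₁ : DirichletCharacter ℂ q₁) (χ₂ : DirichletCharacter ℂ q₂)
    (hχ₁ : χ₁.IsPrimitive) (hχ₂ : χ₂.IsPrimitive) (hpar : χ₁ (-1) * χ₂ (-1) = 1)
    {z : ℂ} (hz : 0 < z.im) :
    Gq χ₁ χ₂ (-1 / (((q₁ * q₂ : ℕ) : ℂ) * z)) =
      χ₂ (-1) * gaussSum' χ₁ * (q₂ : ℂ) / (gaussSum' χ₂ * (q₁ : ℂ)) *
        (((q₁ * q₂ : ℕ) : ℂ) * z ^ 2) * Gq χ₂ χ₁ z := by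
  have h1 : (q₁ : ℂ) ≠ 0 := by exact_mod_cast NeZero.ne q₁
  have h2 : (q₂ : ℂ) ≠ 0 := by exact_mod_cast NeZero.ne q₂
  have hz0 : z ≠ 0 := by rintro rfl; simp at hz
  have hg := gaussSum'_ne_zero χ₂ hχ₂
  have hpi : (Real.pi : ℂ) ≠ 0 := by exact_mod_cast Real.pi_ne_zero
  have ht : 0 < ((q₁ : ℂ) * z).im := by
    have : (0 : ℝ) < q₁ := by positivity
    simpa using mul_pos this hz
  have h := exchange hq₁ hq₂ χ₁ χ₂ hχ₁ hχ₂ ht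
  rw [fold hq₁ χ₁ χ₂ hχ₂ hpar (neg_inv_im ht), fold hq₂ χ₂ χ₁ hχ₁ (by rw [mul_comm]; exact hpar) ht,
    mul_div_cancel_left₀ _ h1, div_div, mul_right_comm] at h
  have hsq : χ₂ (-1) * χ₂ (-1) = 1 := by rw [← map_mul]; simp
  have hc : χ₁ (-1) = χ₂ (-1) := by linear_combination χ₂ (-1) * hpar - χ₁ (-1) * hsq
  push_cast
  rw [hc] at h
  field_simp at h ⊢
  linear_combination -h

lemma hasDerivAt_fE {q₁ q₂ : ℕ} (χ₁ : DirichletCharacter ℂ q₁) (χ₂ : DirichletCharacter ℂ q₂)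
    {z : ℂ} (hz : 0 < z.im) :
    HasDerivAt (fE χ₁ χ₂) (2 * Real.pi * Complex.I * Gq χ₁ χ₂ z) z := by
  let a : ℕ+ × ℕ+ → ℂ := fun c =>
    χ₁ ((c.1 : ℕ) : ZMod q₁) * (starRingEnd ℂ) (χ₂ ((c.2 : ℕ) : ZMod q₂))
  have ha (c) : ‖a c‖ ≤ 1 := by
    simp only [a, norm_mul, RCLike.norm_conj]
    exact mul_le_one₀ (DirichletCharacter.norm_le_one _ _) (norm_nonneg _)
      (DirichletCharacter.norm_le_one _ _)
  let g : ℕ+ × ℕ+ → ℂ → ℂ := fun c y =>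
    a c / ((c.1 : ℕ) : ℂ) * eC (((c.2 : ℕ) : ℂ) * ((c.1 : ℕ) : ℂ) * y)
  let g' : ℕ+ × ℕ+ → ℂ → ℂ := fun c y =>
    2 * Real.pi * Complex.I * (a c * ((c.2 : ℕ) : ℂ) *
      eC (((c.2 : ℕ) : ℂ) * ((c.1 : ℕ) : ℂ) * y))
  have hgs {y : ℂ} (hy : 0 < y.im) : Summable fun c => g c y := by
    refine Summable.of_norm_bounded (summable_kl hy) fun c => ?_
    simp only [g]
    rw [norm_mul, norm_div]
    refine mul_le_mul_of_nonneg_right ?_ (norm_nonneg _)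
    have h1 : (1 : ℝ) ≤ (c.1 : ℕ) := by exact_mod_cast c.1.2
    have h2 : (1 : ℝ) ≤ (c.2 : ℕ) := by exact_mod_cast c.2.2
    rw [Complex.norm_natCast]
    exact (div_le_one_of_le₀ ((ha c).trans h1) (by positivity)).trans h2
  have hfE {y : ℂ} (hy : 0 < y.im) : fE χ₁ χ₂ y = ∑' c, g c y := by
    rw [(hgs hy).tsum_prod]
    rfl
  have hg's {y : ℂ} (hy : 0 < y.im) :
      Summable fun c : ℕ+ × ℕ+ => a c * ((c.2 : ℕ) : ℂ) *
      eC (((c.2 : ℕ) : ℂ) * ((c.1 : ℕ) : ℂ) * y) := by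
    refine Summable.of_norm_bounded (summable_kl hy) fun c => ?_
    rw [norm_mul, norm_mul, Complex.norm_natCast]
    refine mul_le_mul_of_nonneg_right ?_ (norm_nonneg _)
    exact mul_le_of_le_one_left (by positivity) (ha c)
  have hG : 2 * Real.pi * Complex.I * Gq χ₁ χ₂ z = ∑' c, g' c z := by
    simp only [g']
    rw [tsum_mul_left, (hg's hz).tsum_prod, Gq]
    congr 1
    refine tsum_congr fun l => ?_
    rw [Lq, ← tsum_mul_left]
    refine tsum_congr fun k => ?_
    simp only [a]
    rw [mul_assoc ((k : ℕ) : ℂ) _ z]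
    ring
  rw [hG]
  set ε : ℝ := z.im / 2 with hε
  have hε0 : 0 < ε := by positivity
  have hopen : IsOpen {y : ℂ | ε < y.im} := isOpen_lt continuous_const Complex.continuous_im
  have hzmem : z ∈ {y : ℂ | ε < y.im} := by
    simp only [Set.mem_ofPred_eq, hε]; linarith
  have hεI : 0 < ((ε : ℂ) * Complex.I).im := by simpa using hε0
  have key : HasDerivAt (fun y => ∑' c, g c y) (∑' c, g' c z) z := by
    refine hasDerivAt_tsum_of_isPreconnected (t := {y : ℂ | ε < y.im})
      ((summable_kl hεI).mul_left (2 * Real.pi)) hopen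
      (convex_halfSpace_im_gt ε).isPreconnected ?_ ?_ hzmem (hgs hz) hzmem
    · intro c y _
      have hl : ((c.1 : ℕ) : ℂ) ≠ 0 := by exact_mod_cast c.1.ne_zero
      have h1 : HasDerivAt (fun y : ℂ => 2 * Real.pi * Complex.I *
          (((c.2 : ℕ) : ℂ) * ((c.1 : ℕ) : ℂ) * y))
          (2 * Real.pi * Complex.I * (((c.2 : ℕ) : ℂ) * ((c.1 : ℕ) : ℂ) * 1)) y :=
        ((hasDerivAt_id y).const_mul _).const_mul _
      have h2 := h1.cexp.const_mul (a c / ((c.1 : ℕ) : ℂ))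
      refine h2.congr_deriv ?_
      simp only [g', eC]
      field_simp
    · intro c y hy
      simp only [g']
      rw [norm_mul, norm_mul _ (eC _), norm_mul (a c), Complex.norm_natCast]
      have hn : ‖(2 * Real.pi * Complex.I : ℂ)‖ = 2 * Real.pi := by
        simp [abs_of_pos Real.pi_pos]
      rw [hn]
      have he : ‖eC (((c.2 : ℕ) : ℂ) * ((c.1 : ℕ) : ℂ) * y)‖ ≤
          ‖eC (((c.2 : ℕ) : ℂ) * ((c.1 : ℕ) : ℂ) * ((ε : ℂ) * Complex.I))‖ := by
        rw [eC_kl, eC_kl, norm_pow, norm_pow]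
        refine pow_le_pow_left₀ (norm_nonneg _) ?_ _
        rw [norm_eC, norm_eC, Real.exp_le_exp]
        have : ((ε : ℂ) * Complex.I).im = ε := by simp
        rw [this]
        have hy' : ε < y.im := hy
        have := Real.pi_pos
        gcongr
      have := Real.pi_pos
      refine mul_le_mul_of_nonneg_left ?_ (by positivity)
      refine mul_le_mul ?_ he (norm_nonneg _) (by positivity)
      exact mul_le_of_le_one_left (by positivity) (ha c)
  refine key.congr_of_eventuallyEq ?_
  filter_upwards [hopen.mem_nhds hzmem] with y hy
  exact hfE (hε0.trans hy)

theorem fricke_phi_constant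
    {q₁ q₂ : ℕ} (hq₁ : 1 < q₁) (hq₂ : 1 < q₂)
    (χ₁ : DirichletCharacter ℂ q₁) (χ₂ : DirichletCharacter ℂ q₂)
    (hχ₁ : χ₁.IsPrimitive) (hχ₂ : χ₂.IsPrimitive)
    (hpar : χ₁ (-1) * χ₂ (-1) = 1)
    (z w : ℂ) (hz : 0 < z.im) (hw : 0 < w.im) :
    fE χ₁ χ₂ (-1 / (((q₁ * q₂ : ℕ) : ℂ) * z)) -
      χ₂ (-1) * gaussSum' χ₁ * (q₂ : ℂ) / (gaussSum' χ₂ * (q₁ : ℂ)) * fE χ₂ χ₁ z =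
    fE χ₁ χ₂ (-1 / (((q₁ * q₂ : ℕ) : ℂ) * w)) -
      χ₂ (-1) * gaussSum' χ₁ * (q₂ : ℂ) / (gaussSum' χ₂ * (q₁ : ℂ)) * fE χ₂ χ₁ w := by
  have : NeZero q₁ := ⟨by omega⟩
  have : NeZero q₂ := ⟨by omega⟩
  have hN : ((q₁ * q₂ : ℕ) : ℂ) ≠ 0 := by exact_mod_cast NeZero.ne (q₁ * q₂)
  set δ : ℂ := χ₂ (-1) * gaussSum' χ₁ * (q₂ : ℂ) / (gaussSum' χ₂ * (q₁ : ℂ)) with hδ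
  have hopen : IsOpen {y : ℂ | 0 < y.im} := isOpen_lt continuous_const Complex.continuous_im
  have hd : ∀ y ∈ {y : ℂ | 0 < y.im}, HasDerivAt (fun y => fE χ₁ χ₂ (-1 / (((q₁ * q₂ : ℕ) : ℂ) * y)) -
      δ * fE χ₂ χ₁ y) 0 y := by
    intro y hy
    have hy' : 0 < y.im := hy
    have hy0 : y ≠ 0 := by rintro rfl; simp at hy'
    have him : 0 < (((q₁ * q₂ : ℕ) : ℂ) * y).im := by
      have : (0 : ℝ) < (q₁ * q₂ : ℕ) := by exact_mod_cast Nat.pos_of_ne_zero (NeZero.ne (q₁ * q₂))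
      have h := mul_pos this hy'
      rwa [← Complex.im_ofReal_mul, Complex.ofReal_natCast] at h
    have h1 : HasDerivAt (fun y : ℂ => -1 / (((q₁ * q₂ : ℕ) : ℂ) * y))
        (1 / (((q₁ * q₂ : ℕ) : ℂ) * y ^ 2)) y := by
      have := ((hasDerivAt_inv hy0).const_mul (-(((q₁ * q₂ : ℕ) : ℂ))⁻¹))
      refine (this.congr_deriv ?_).congr_of_eventuallyEq (Filter.Eventually.of_forall fun x => ?_)
      · simp [mul_comm]
      · simp only [neg_div, one_div, mul_inv, neg_mul]
    have h2 := (hasDerivAt_fE χ₁ χ₂ (neg_inv_im him)).comp y h1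
    have h3 := h2.sub ((hasDerivAt_fE χ₂ χ₁ hy').const_mul δ)
    refine HasDerivAt.congr_deriv h3 ?_
    rw [Gq_fricke hq₁ hq₂ χ₁ χ₂ hχ₁ hχ₂ hpar hy', ← hδ]
    field_simp
    ring
  exact hopen.is_const_of_deriv_eq_zero (convex_halfSpace_im_gt 0).isPreconnected
    (fun y hy => (hd y hy).differentiableAt.differentiableWithinAt)
    (fun y hy => (hd y hy).deriv) hz hw
end

section
/- Let χ₁, χ₂ be primitive Dirichlet characters of conductors q₁, q₂ respectively, with q₁, q₂ > 1 and χ₁(−1)χ₂(−1) = 1. Then f_{χ₁,χ₂} is complex differentiable at every point z of the upper half-plane ℍ, with derivative f'_{χ₁,χ₂}(z) = πi · E_{2,χ₁,χ₂}(z), where E_{2,χ₁,χ₂}(z) = 2·∑_{n=1}^∞ ( ∑_{d | n, d ≥ 1} χ₁(n/d)·conj(χ₂)(d)·d ) · e(nz). Equivalently, (1/(πi))·(d/dz) f_{χ₁,χ₂}(z) = E_{2,χ₁,χ₂}(z), the holomorphic weight-2 Eisenstein series attached to χ₁ and χ₂. -/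
open Complex

/-- The holomorphic weight-2 Eisenstein series
`E_{2,χ₁,χ₂}(z) = 2 ∑_{n≥1} (∑_{d∣n} χ₁(n/d) conj(χ₂)(d) d) e(nz)`. -/
noncomputable def E2 {q₁ q₂ : ℕ} (χ₁ : DirichletCharacter ℂ q₁)
    (χ₂ : DirichletCharacter ℂ q₂) (z : ℂ) : ℂ :=
  2 * ∑' n : ℕ+,
    (∑ d ∈ (n : ℕ).divisors,
      χ₁ ((((n : ℕ) / d : ℕ) : ℕ) : ZMod q₁) * (starRingEnd ℂ) (χ₂ ((d : ℕ) : ZMod q₂)) * (d : ℂ)) *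
      eC ((n : ℂ) * z)

lemma norm_eC_le (c : ℝ) (l k : ℕ+) (y : ℂ) (hy : c < y.im) :
    ‖eC ((k : ℂ) * (l : ℂ) * y)‖ ≤ (Real.exp (-(2 * Real.pi * c))) ^ (l * k : ℕ) := by
  rw [eC, Complex.norm_exp, ← Real.exp_nat_mul]
  apply Real.exp_le_exp.mpr
  have h1 : (2 * (Real.pi : ℂ) * Complex.I * ((k : ℂ) * (l : ℂ) * y)).re
      = -(2 * Real.pi * ((l : ℝ) * (k : ℝ)) * y.im) := by
    have : (2 * (Real.pi : ℂ) * Complex.I * ((k : ℂ) * (l : ℂ) * y))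
        = ((2 * Real.pi * ((l : ℝ) * (k : ℝ)) : ℝ) : ℂ) * (Complex.I * y) := by
      push_cast; ring
    rw [this, Complex.re_ofReal_mul]
    simp
  rw [h1]
  push_cast
  have h2 : 0 ≤ 2 * Real.pi * ((l : ℝ) * (k : ℝ)) := by positivity
  nlinarith [mul_le_mul_of_nonneg_left hy.le h2]

lemma norm_term_le {q₁ q₂ : ℕ} (χ₁ : DirichletCharacter ℂ q₁) (χ₂ : DirichletCharacter ℂ q₂)
    (a : ZMod q₁) (b : ZMod q₂) : ‖χ₁ a * (starRingEnd ℂ) (χ₂ b)‖ ≤ 1 := by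
  rw [norm_mul, RCLike.norm_conj]
  exact mul_le_one₀ (χ₁.norm_le_one a) (norm_nonneg _) (χ₂.norm_le_one b)

lemma fE_summable {q₁ q₂ : ℕ} (χ₁ : DirichletCharacter ℂ q₁) (χ₂ : DirichletCharacter ℂ q₂)
    (c : ℝ) (hc : 0 < c) (y : ℂ) (hy : c < y.im) :
    Summable fun p : ℕ+ × ℕ+ =>
      χ₁ ((p.1 : ℕ) : ZMod q₁) * (starRingEnd ℂ) (χ₂ ((p.2 : ℕ) : ZMod q₂)) / (p.1 : ℂ)
        * eC ((p.2 : ℂ) * (p.1 : ℂ) * y) := by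
  have hr : ‖Real.exp (-(2 * Real.pi * c))‖ < 1 := by
    rw [Real.norm_eq_abs, Real.abs_exp, Real.exp_lt_one_iff]
    have := Real.pi_pos
    have : 0 < 2 * Real.pi * c := by positivity
    linarith
  refine Summable.of_norm_bounded (summable_prod_mul_pow 0 hr) ?_
  rintro ⟨l, k⟩
  rw [norm_mul, norm_div]
  simp only [pow_zero, one_mul]
  refine (mul_le_of_le_one_left (norm_nonneg _) ?_).trans (norm_eC_le c l k y hy)
  have hl : (1 : ℝ) ≤ ‖(l : ℂ)‖ := by
    simpa using (by exact_mod_cast l.pos : (1 : ℝ) ≤ (l : ℕ))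
  exact div_le_one_of_le₀ ((norm_term_le χ₁ χ₂ _ _).trans hl) (norm_nonneg _)

theorem f_deriv_eisenstein
    {q₁ q₂ : ℕ} (hq₁ : 1 < q₁) (hq₂ : 1 < q₂)
    (χ₁ : DirichletCharacter ℂ q₁) (χ₂ : DirichletCharacter ℂ q₂)
    (hχ₁ : χ₁.IsPrimitive) (hχ₂ : χ₂.IsPrimitive)
    (hpar : χ₁ (-1) * χ₂ (-1) = 1)
    (z : ℂ) (hz : 0 < z.im) :
    HasDerivAt (fE χ₁ χ₂) ((Real.pi : ℂ) * Complex.I * E2 χ₁ χ₂ z) z := by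
  set c := z.im / 2 with hcdef
  have hc : 0 < c := by positivity
  have hcz : c < z.im := by rw [hcdef]; linarith
  have hr : ‖Real.exp (-(2 * Real.pi * c))‖ < 1 := by
    rw [Real.norm_eq_abs, Real.abs_exp, Real.exp_lt_one_iff]
    have := Real.pi_pos
    have : 0 < 2 * Real.pi * c := by positivity
    linarith
  let g' : ℕ+ × ℕ+ → ℂ → ℂ := fun p y =>
    (2 * Real.pi * Complex.I) *
      (χ₁ ((p.1 : ℕ) : ZMod q₁) * (starRingEnd ℂ) (χ₂ ((p.2 : ℕ) : ZMod q₂)) * (p.2 : ℂ)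
        * eC ((p.2 : ℂ) * (p.1 : ℂ) * y))
  have hu := (summable_prod_mul_pow 1 hr).mul_left (2 * Real.pi)
  have hopen : IsOpen {w : ℂ | c < w.im} := isOpen_lt continuous_const Complex.continuous_im
  have hb : ∀ (p : ℕ+ × ℕ+) (y : ℂ), y ∈ {w : ℂ | c < w.im} → ‖g' p y‖ ≤
      2 * Real.pi * ((p.2 : ℝ) ^ 1 * Real.exp (-(2 * Real.pi * c)) ^ (p.1 * p.2 : ℕ)) := by
    rintro ⟨l, k⟩ y hy
    have h1 : ‖(2 * Real.pi * Complex.I : ℂ)‖ = 2 * Real.pi := by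
      simp [abs_of_pos Real.pi_pos]
    simp only [g']
    rw [norm_mul, h1, norm_mul, norm_mul, pow_one]
    have h2 : ‖(k : ℂ)‖ = (k : ℝ) := by simp
    rw [h2]
    have := Real.pi_pos
    gcongr
    · exact mul_le_of_le_one_left (by positivity) (norm_term_le χ₁ χ₂ _ _)
    · exact norm_eC_le c l k y hy
  have hd := hasDerivAt_tsum_of_isPreconnected (g' := g')
    (g := fun (p : ℕ+ × ℕ+) (y : ℂ) =>
      χ₁ ((p.1 : ℕ) : ZMod q₁) * (starRingEnd ℂ) (χ₂ ((p.2 : ℕ) : ZMod q₂)) / (p.1 : ℂ)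
        * eC ((p.2 : ℂ) * (p.1 : ℂ) * y))
    hu hopen (convex_halfSpace_im_gt c).isPreconnected
    (by
      rintro ⟨l, k⟩ y -
      have hl : (l : ℂ) ≠ 0 := by simp
      have h0 := ((((hasDerivAt_id y).const_mul ((k : ℂ) * (l : ℂ))).const_mul
        (2 * Real.pi * Complex.I : ℂ)).cexp).const_mul
          (χ₁ ((l : ℕ) : ZMod q₁) * (starRingEnd ℂ) (χ₂ ((k : ℕ) : ZMod q₂)) / (l : ℂ))
      simp only [g', eC]
      refine h0.congr_deriv ?_
      simp only [id]
      field_simp)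
    hb (y₀ := z) hcz (fE_summable χ₁ χ₂ c hc z hcz) hcz
  have hg's : Summable fun p => g' p z := Summable.of_norm_bounded hu fun p => hb p z hcz
  have hsum : ∑' p, g' p z = (Real.pi : ℂ) * Complex.I * E2 χ₁ χ₂ z := by
    have hg'σ : Summable fun x => g' (sigmaAntidiagonalEquivProd x) z :=
      sigmaAntidiagonalEquivProd.summable_iff.mpr hg's
    rw [← sigmaAntidiagonalEquivProd.tsum_eq,
      Summable.tsum_sigma hg'σ, E2,
      ← mul_assoc, ← tsum_mul_left]
    refine tsum_congr fun n => ?_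
    rw [tsum_fintype, Finset.univ_eq_attach]
    simp only [g', sigmaAntidiagonalEquivProd, divisorsAntidiagonalFactors, PNat.mk_coe,
      Equiv.coe_fn_mk]
    rw [(n : ℕ).divisorsAntidiagonal.sum_attach fun x : ℕ × ℕ ↦ (2 * Real.pi * Complex.I) *
      (χ₁ ((x.1 : ℕ) : ZMod q₁) * (starRingEnd ℂ) (χ₂ ((x.2 : ℕ) : ZMod q₂)) * (x.2 : ℂ)
        * eC ((x.2 : ℂ) * (x.1 : ℂ) * z)),
      Nat.sum_divisorsAntidiagonal' fun x y : ℕ ↦ (2 * Real.pi * Complex.I) *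
      (χ₁ ((x : ℕ) : ZMod q₁) * (starRingEnd ℂ) (χ₂ ((y : ℕ) : ZMod q₂)) * (y : ℂ)
        * eC ((y : ℂ) * (x : ℂ) * z)), Finset.sum_mul, Finset.mul_sum]
    refine Finset.sum_congr rfl fun d hd => ?_
    have : (d : ℂ) * (((n : ℕ) / d : ℕ) : ℂ) = (n : ℂ) := by
      rw [← Nat.cast_mul, Nat.mul_div_cancel' (Nat.dvd_of_mem_divisors hd)]
    rw [this]
    ring
  rw [← hsum]
  refine hd.congr_of_eventuallyEq ?_
  filter_upwards [hopen.mem_nhds hcz] with y hy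
  rw [fE, (fE_summable χ₁ χ₂ c hc y hy).tsum_prod]
end
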